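/- For any ground GZ-formula φ and any interpretation I = ⟨σ^h,σ^t,H,T⟩ coherent w.r.t. aggregates: I ⊨ φ if and only if H ⊨_cl φ^T, where φ^T is the GZ-reduct of φ w.r.t. T. -/

import Mathlib

open Classical

noncomputable section

/-! ## Worlds (here and there) -/

inductive W : Type
  | h
  | t

/-- The ordering `h ≤ t` on worlds. -/
def W.le : W → W → Prop
  | .h, _ => True
  | .t, .t => True
  | .t, .h => False

/-! ## Tuples: nonempty finite tuples, encoded as head + tail -/

abbrev Tup (α : Type u) : Type u := α × List α

/-- The tuple `(g 0, …, g n)` determined by a family on `Fin (n+1)`. -/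
def famToTup {α : Type u} {n : ℕ} (g : Fin (n + 1) → α) : Tup α :=
  (g 0, List.ofFn fun i : Fin n => g i.succ)

/-- Combine a finite family of optional values into an optional family:
`some` iff all components are defined. -/
def optFam {α : Type u} {m : ℕ} (f : Fin m → Option α) : Option (Fin m → α) :=
  if h : ∀ i, (f i).isSome then some fun i => (f i).get (h i) else none

/-! ## The domain `D`: atoms (Herbrand terms) plus, at each finite level,
all sets of (nonempty) tuples over the previous level.
We realise it as the quotient of a type of "pre-domain elements" of finite
rank by extensional equivalence. -/

/-- Pre-domain elements over a type `A` of atoms: an atom, or a set of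
nonempty tuples (each tuple encoded as head + tail), indexed by an arbitrary
(small) index type. -/
inductive PD (A : Type) : Type 1
  | atom : A → PD A
  | set : (ι : Type) → (ι → PD A) → (ι → List (PD A)) → PD A

/-- `x` has rank at most `n` (atoms have rank `0`). -/
def PD.rankLe {A : Type} : ℕ → PD A → Prop
  | 0, .atom _ => True
  | 0, .set _ _ _ => False
  | _ + 1, .atom _ => True
  | n + 1, .set _ hd tl => ∀ i, PD.rankLe n (hd i) ∧ ∀ z ∈ tl i, PD.rankLe n z

/-- Finite rank: the element appears at some finite level `D^i` of the
domain hierarchy. -/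
def PD.FiniteRank {A : Type} (x : PD A) : Prop := ∃ n, PD.rankLe n x

/-- Extensional equivalence up to depth `n`. -/
def PD.EquivLe {A : Type} : ℕ → PD A → PD A → Prop
  | 0, .atom a, .atom b => a = b
  | 0, _, _ => False
  | _ + 1, .atom a, .atom b => a = b
  | n + 1, .set _ hd tl, .set _ hd' tl' =>
      (∀ i, ∃ j, PD.EquivLe n (hd i) (hd' j) ∧ List.Forall₂ (PD.EquivLe n) (tl i) (tl' j)) ∧
      (∀ j, ∃ i, PD.EquivLe n (hd i) (hd' j) ∧ List.Forall₂ (PD.EquivLe n) (tl i) (tl' j))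
  | _ + 1, _, _ => False

/-- Extensional equivalence (witnessed at some finite depth). -/
def PD.Equiv {A : Type} (x y : PD A) : Prop := ∃ n, PD.EquivLe n x y

/-- The domain over atoms `A`: finite-rank pre-domain elements modulo
extensional equivalence. -/
def DD (A : Type) : Type 1 :=
  Quot fun x y : { z : PD A // z.FiniteRank } => PD.Equiv x.1 y.1

def toD {A : Type} (x : PD A) (h : x.FiniteRank) : DD A := Quot.mk _ ⟨x, h⟩

def atomD {A : Type} (a : A) : DD A := toD (PD.atom a) ⟨0, by simp [PD.rankLe]⟩

/-- `z` (a pre-domain element) represents the domain element `w`. -/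
def repD {A : Type} (z : PD A) (w : DD A) : Prop := ∃ h, w = toD z h

/-- Membership of a tuple in a domain element (meaningful when the latter
is a set). -/
def dmem {A : Type} (v : Tup (DD A)) (d : DD A) : Prop :=
  ∃ (ι : Type) (hd : ι → PD A) (tl : ι → List (PD A)) (hfr : (PD.set ι hd tl).FiniteRank),
    d = toD (PD.set ι hd tl) hfr ∧ ∃ i, repD (hd i) v.1 ∧ List.Forall₂ repD (tl i) v.2

/-- The domain elements that are sets (the subset `𝒮 = D ∖ D⁰`). -/
def IsSetD {A : Type} (d : DD A) : Prop :=
  ∃ (ι : Type) (hd : ι → PD A) (tl : ι → List (PD A)) (hfr : (PD.set ι hd tl).FiniteRank),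
    d = toD (PD.set ι hd tl) hfr

/-- The domain element whose members are exactly the tuples in `s`
(`none` if there is no such element of the domain). -/
def mkSet? {A : Type} (s : Set (Tup (DD A))) : Option (DD A) :=
  if h : ∃ d : DD A, IsSetD d ∧ ∀ v, dmem v d ↔ v ∈ s then some h.choose else none


universe v

/-! ## Signatures -/

/-- A signature: Herbrand function (constructor) names `C`, evaluable
function names `F`, and predicate names `P`, each with an arity, with at
least one Herbrand constant. -/
structure Sig : Type (v + 1) where
  C : Type
  arC : C → ℕ
  F : Type v
  arF : F → ℕ
  P : Type
  arP : P → ℕ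
  hasConst : ∃ c, arC c = 0

/-- Ground Herbrand terms over constructors `C`. -/
inductive HTerm (C : Type) (ar : C → ℕ) : Type
  | mk : (c : C) → (Fin (ar c) → HTerm C ar) → HTerm C ar

/-- The domain `D` of a signature: the Herbrand universe `Terms_F(C)`
together with all (finite-level) sets of nonempty tuples over it. -/
abbrev D (S : Sig.{v}) : Type 1 := DD (HTerm S.C S.arC)

/-! ## Terms and formulas (with extensional and intensional sets).
Quantified variables and the variables bound by an intensional set are
handled by substitution of arbitrary domain elements (which are available
as constant terms via `GTerm.dom`), so terms and formulas below are the
*ground* terms and *sentences* of the language. -/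

mutual
  inductive GTerm (S : Sig.{v}) : Type (max 1 v)
    /-- every element of the domain is a (ground) term -/
    | dom : D S → GTerm S
    /-- Herbrand (constructor) function application -/
    | ctor : (c : S.C) → (Fin (S.arC c) → GTerm S) → GTerm S
    /-- evaluable function application -/
    | func : (f : S.F) → (Fin (S.arF f) → GTerm S) → GTerm S
    /-- extensional set `{τ⃗₁, …, τ⃗_m}` of `m` tuples of terms, each of
    arity `n+1` -/
    | eset : (m n : ℕ) → (Fin m → Fin (n + 1) → GTerm S) → GTerm S
    /-- intensional set `{x⃗ : τ⃗(x⃗) : φ(x⃗)}` with `k` bound variables and a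
    tuple of `n+1` terms -/
    | iset : (k n : ℕ) → ((Fin k → D S) → Fin (n + 1) → GTerm S) →
        ((Fin k → D S) → Formula S) → GTerm S

  inductive Formula (S : Sig.{v}) : Type (max 1 v)
    | falsum : Formula S
    | verum : Formula S
    | atom : (p : S.P) → (Fin (S.arP p) → GTerm S) → Formula S
    | eq : GTerm S → GTerm S → Formula S
    | and : Formula S → Formula S → Formula S
    | or : Formula S → Formula S → Formula S
    | imp : Formula S → Formula S → Formula S
    | all : (D S → Formula S) → Formula S
    | ex : (D S → Formula S) → Formula S
end

/-- `¬φ` is an abbreviation for `φ → ⊥`. -/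
def Formula.neg {S : Sig.{v}} (φ : Formula S) : Formula S := .imp φ .falsum

/-- Ground atoms over the domain: the Herbrand base. -/
def GAtom (S : Sig.{v}) : Type 1 := Σ p : S.P, Fin (S.arP p) → D S

/-! ## Assignments and interpretations -/

/-- An assignment maps every ground term to a domain element or `none`
(undefined, `u`). -/
abbrev Assign (S : Sig.{v}) := GTerm S → Option (D S)

/-- The conditions an assignment must satisfy: identity on domain
constants, strictness and substitutivity for function application, the
Herbrand interpretation of constructors on atoms, and evaluation of
extensional set terms. -/
def AssignValid {S : Sig.{v}} (σ : Assign S) : Prop :=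
  (∀ d, σ (.dom d) = some d) ∧
  (∀ c args, (∃ i, σ (args i) = none) → σ (.ctor c args) = none) ∧
  (∀ c args (ds : Fin (S.arC c) → D S), (∀ i, σ (args i) = some (ds i)) →
      σ (.ctor c args) = σ (.ctor c fun i => .dom (ds i))) ∧
  (∀ c (hs : Fin (S.arC c) → HTerm S.C S.arC),
      σ (.ctor c fun i => .dom (atomD (hs i))) = some (atomD (HTerm.mk c hs))) ∧
  (∀ f args, (∃ i, σ (args i) = none) → σ (.func f args) = none) ∧
  (∀ f args (ds : Fin (S.arF f) → D S), (∀ i, σ (args i) = some (ds i)) →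
      σ (.func f args) = σ (.func f fun i => .dom (ds i))) ∧
  (∀ m n tups, (∃ j i, σ (tups j i) = none) → σ (.eset m n tups) = none) ∧
  (∀ m n tups (ds : Fin m → Fin (n + 1) → D S), (∀ j i, σ (tups j i) = some (ds j i)) →
      σ (.eset m n tups) = mkSet? { v | ∃ j, v = famToTup (ds j) })

/-- `σ ≼ σ'` : on every ground term, `σ` agrees with `σ'` or is undefined. -/
def AssignLe {S : Sig.{v}} (σ σ' : Assign S) : Prop :=
  ∀ τ, σ τ = σ' τ ∨ σ τ = none

/-- An interpretation `⟨σʰ, σᵗ, Iʰ, Iᵗ⟩`. -/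
structure Interp (S : Sig.{v}) : Type (max 1 v) where
  sh : Assign S
  st : Assign S
  Ih : Set (GAtom S)
  It : Set (GAtom S)

/-- The assignment of `I` at world `w`. -/
def Interp.s {S : Sig.{v}} (I : Interp S) : W → Assign S
  | .h => I.sh
  | .t => I.st

/-- The atoms of `I` at world `w`. -/
def Interp.atoms {S : Sig.{v}} (I : Interp S) : W → Set (GAtom S)
  | .h => I.Ih
  | .t => I.It

/-- The defining conditions of an interpretation: both assignments are
proper assignments, `σʰ ≼ σᵗ` and `Iʰ ⊆ Iᵗ`. -/
def Interp.Valid {S : Sig.{v}} (I : Interp S) : Prop :=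
  AssignValid I.sh ∧ AssignValid I.st ∧ AssignLe I.sh I.st ∧ I.Ih ⊆ I.It

/-! ## 𝒮-satisfaction -/

/-- `SatS I w φ` : `I, w ⊨_𝒮 φ`. -/
def SatS {S : Sig.{v}} (I : Interp S) : W → Formula S → Prop
  | _, .falsum => False
  | _, .verum => True
  | w, .atom p args => ∃ ds : Fin (S.arP p) → D S,
      (∀ i, I.s w (args i) = some (ds i)) ∧ (⟨p, ds⟩ : GAtom S) ∈ I.atoms w
  | w, .eq t1 t2 => ∃ d, I.s w t1 = some d ∧ I.s w t2 = some d
  | w, .and a b => SatS I w a ∧ SatS I w b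
  | w, .or a b => SatS I w a ∨ SatS I w b
  | w, .imp a b => ∀ w', W.le w w' → (SatS I w' a → SatS I w' b)
  | w, .all b => ∀ d, SatS I w (b d)
  | w, .ex b => ∃ d, SatS I w (b d)

/-! ## Extension of intensional sets and the coherent closure -/

/-- The extension `ext(I, w, {x⃗ : τ⃗(x⃗) : φ(x⃗)})`: the set of values of the
tuples `τ⃗(c⃗)` for those `c⃗ ∈ D^k` with `I, w ⊨_𝒮 φ(c⃗)`; it is undefined if
one of these values is undefined (or if the resulting collection is not a
member of the domain). -/
def extw {S : Sig.{v}} (I : Interp S) (w : W) (k n : ℕ)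
    (tv : (Fin k → D S) → Fin (n + 1) → GTerm S)
    (φ : (Fin k → D S) → Formula S) : Option (D S) :=
  if ∃ c : Fin k → D S, SatS I w (φ c) ∧ ∃ i, I.s w (tv c i) = none then none
  else
    mkSet? { val | ∃ (c : Fin k → D S) (ds : Fin (n + 1) → D S),
      SatS I w (φ c) ∧ (∀ i, I.s w (tv c i) = some (ds i)) ∧ val = famToTup ds }

/-- The assignment `σ_I^w` of the coherent closure of `I`: it agrees with
`σ^w` on terms without intensional sets, it assigns to an intensional set
its extension at `t`, at `h` its extension when the two extensions agree
(and `u` otherwise), and is extended to all remaining terms by the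
assignment conditions. -/
def cval {S : Sig.{v}} (I : Interp S) (w : W) : GTerm S → Option (D S)
  | .dom d => some d
  | .ctor c args =>
      match optFam fun i => cval I w (args i) with
      | none => none
      | some ds => I.s w (.ctor c fun i => .dom (ds i))
  | .func f args =>
      match optFam fun i => cval I w (args i) with
      | none => none
      | some ds => I.s w (.func f fun i => .dom (ds i))
  | .eset _ _ tups =>
      match optFam fun j => optFam fun i => cval I w (tups j i) with
      | none => none
      | some g => mkSet? { val | ∃ j, val = famToTup (g j) }
  | .iset k n tv φ =>
      match w with
      | .t => extw I .t k n tv φ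
      | .h => if extw I .h k n tv φ = extw I .t k n tv φ then extw I .h k n tv φ else none

/-- The coherent closure `C(I)` of an interpretation. -/
def CohC {S : Sig.{v}} (I : Interp S) : Interp S :=
  ⟨cval I .h, cval I .t, I.Ih, I.It⟩

/-- `I` is coherent (w.r.t. intensional sets) iff `I = C(I)`. -/
def Interp.Coherent {S : Sig.{v}} (I : Interp S) : Prop := CohC I = I

/-! ## 0-formulas (no intensional sets) and `SQHT⁼_F` over `⟨C ∪ 𝒮, F, P⟩`.
A `0`-formula over `Σ = ⟨C, F, P⟩` is at the same time an `SQHT⁼_F` formula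
over the signature `⟨C ∪ 𝒮, F, P⟩`, whose Herbrand universe is the domain
`D`.  An `SQHT⁼_F` interpretation over `⟨C ∪ 𝒮, F, P⟩` is an interpretation
whose assignments are only defined on terms without intensional sets. -/

mutual
  def IsZeroT {S : Sig.{v}} : GTerm S → Prop
    | .dom _ => True
    | .ctor _ args => ∀ i, IsZeroT (args i)
    | .func _ args => ∀ i, IsZeroT (args i)
    | .eset _ _ tups => ∀ j i, IsZeroT (tups j i)
    | .iset _ _ _ _ => False

  def IsZeroF {S : Sig.{v}} : Formula S → Prop
    | .falsum => True
    | .verum => True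
    | .atom _ args => ∀ i, IsZeroT (args i)
    | .eq t1 t2 => IsZeroT t1 ∧ IsZeroT t2
    | .and a b => IsZeroF a ∧ IsZeroF b
    | .or a b => IsZeroF a ∧ IsZeroF b
    | .imp a b => IsZeroF a ∧ IsZeroF b
    | .all b => ∀ d, IsZeroF (b d)
    | .ex b => ∀ d, IsZeroF (b d)
end

/-- An `SQHT⁼_F` interpretation over `⟨C ∪ 𝒮, F, P⟩`: assignments are given
on the terms without intensional sets only. -/
structure FInterp (S : Sig.{v}) : Type (max 1 v) where
  sh : { τ : GTerm S // IsZeroT τ } → Option (D S)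
  st : { τ : GTerm S // IsZeroT τ } → Option (D S)
  Ih : Set (GAtom S)
  It : Set (GAtom S)

/-- The restriction `Î` of an `SQHT⁼_𝒮` interpretation to the terms without
intensional sets. -/
def Interp.hat {S : Sig.{v}} (I : Interp S) : FInterp S :=
  ⟨fun τ => I.sh τ.1, fun τ => I.st τ.1, I.Ih, I.It⟩

/-- The canonical extension of an `SQHT⁼_F` interpretation to all terms
(undefined outside terms without intensional sets); it is used to evaluate
`SQHT⁼_F` satisfaction, which only depends on the values on terms without
intensional sets. -/
def FInterp.toInterp {S : Sig.{v}} (J : FInterp S) : Interp S :=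
  ⟨fun τ => if h : IsZeroT τ then J.sh ⟨τ, h⟩ else none,
   fun τ => if h : IsZeroT τ then J.st ⟨τ, h⟩ else none, J.Ih, J.It⟩

/-- `SQHT⁼_F` satisfaction `I, w ⊨_F φ` (for `0`-formulas `φ`, i.e.
`SQHT⁼_F` formulas over `⟨C ∪ 𝒮, F, P⟩`): the same clauses as `⊨_𝒮`, with
quantifiers ranging over the Herbrand universe of `⟨C ∪ 𝒮, F, P⟩`. -/
def SatF {S : Sig.{v}} (J : FInterp S) (w : W) (φ : Formula S) : Prop :=
  SatS J.toInterp w φ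

/-- Validity of an `SQHT⁼_F` interpretation. -/
def FInterp.Valid {S : Sig.{v}} (J : FInterp S) : Prop := J.toInterp.Valid

/-! ## Orderings between interpretations, equilibrium and stable models -/

/-- `I₁ ≼ I₂` : same `there` component, smaller `here` component. -/
def ILe {S : Sig.{v}} (I1 I2 : Interp S) : Prop :=
  I1.It = I2.It ∧ I1.st = I2.st ∧ I1.Ih ⊆ I2.Ih ∧ AssignLe I1.sh I2.sh

/-- `I₁ ≺ I₂`. -/
def ILt {S : Sig.{v}} (I1 I2 : Interp S) : Prop := ILe I1 I2 ∧ I1 ≠ I2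

/-- The total interpretation `⟨σ, T⟩`. -/
def totalI {S : Sig.{v}} (σ : Assign S) (T : Set (GAtom S)) : Interp S := ⟨σ, σ, T, T⟩

/-- `I` is a model of the theory `Γ` : `I` is a (coherent) interpretation
and `I, h ⊨_𝒮 φ` for every `φ ∈ Γ`. -/
def ModelS {S : Sig.{v}} (I : Interp S) (Γ : Set (Formula S)) : Prop :=
  I.Valid ∧ I.Coherent ∧ ∀ φ ∈ Γ, SatS I .h φ

/-- `⟨σ, T⟩` is an equilibrium model of `Γ`. -/
def EqModelS {S : Sig.{v}} (Γ : Set (Formula S)) (σ : Assign S) (T : Set (GAtom S)) : Prop :=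
  ModelS (totalI σ T) Γ ∧ ∀ I', ILt I' (totalI σ T) → ¬ ModelS I' Γ

/-- `T` is a stable model of `Γ` (`SQHT⁼_𝒮` equilibrium semantics). -/
def StableS {S : Sig.{v}} (Γ : Set (Formula S)) (T : Set (GAtom S)) : Prop :=
  ∃ σ, EqModelS Γ σ T

/-- The ordering on `SQHT⁼_F` assignments. -/
def FAssignLe {S : Sig.{v}} (σ σ' : { τ : GTerm S // IsZeroT τ } → Option (D S)) : Prop :=
  ∀ τ, σ τ = σ' τ ∨ σ τ = none

/-- `≼` on `SQHT⁼_F` interpretations. -/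
def FILe {S : Sig.{v}} (J1 J2 : FInterp S) : Prop :=
  J1.It = J2.It ∧ J1.st = J2.st ∧ J1.Ih ⊆ J2.Ih ∧ FAssignLe J1.sh J2.sh

def FILt {S : Sig.{v}} (J1 J2 : FInterp S) : Prop := FILe J1 J2 ∧ J1 ≠ J2

def totalF {S : Sig.{v}} (σ : { τ : GTerm S // IsZeroT τ } → Option (D S))
    (T : Set (GAtom S)) : FInterp S := ⟨σ, σ, T, T⟩

/-- `J` is an `SQHT⁼_F` model of `Γ`. -/
def ModelF {S : Sig.{v}} (J : FInterp S) (Γ : Set (Formula S)) : Prop :=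
  J.Valid ∧ ∀ φ ∈ Γ, SatF J .h φ

/-- `T` is a stable model of `Γ` under the `SQHT⁼_F` equilibrium semantics
over the signature `⟨C ∪ 𝒮, F, P⟩`. -/
def StableF {S : Sig.{v}} (Γ : Set (Formula S)) (T : Set (GAtom S)) : Prop :=
  ∃ σ, ModelF (totalF σ T) Γ ∧ ∀ J', FILt J' (totalF σ T) → ¬ ModelF J' Γ
/-! ## Aggregates and the language `𝒜log` of Gelfond–Zhang. -/

/-- Arithmetic comparison relations. -/
inductive CmpOp : Type
  | eq
  | le
  | ge
  | lt
  | gt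
  | ne

def CmpOp.eval : CmpOp → ℤ → ℤ → Prop
  | .eq => fun a b => a = b
  | .le => fun a b => a ≤ b
  | .ge => fun a b => a ≥ b
  | .lt => fun a b => a < b
  | .gt => fun a b => a > b
  | .ne => fun a b => a ≠ b

/-- Extra structure on a signature for aggregates and arithmetic:
a set `𝒜` of unary aggregate names among the evaluable functions, each with
its associated function `f̂` (whose value is only relevant on the sets `𝒮`),
integer constants among the Herbrand constants, and arithmetic comparison
predicates. -/
structure GZExt (S : Sig.{0}) : Type 1 where
  isAgg : S.F → Prop
  agg_ar : ∀ f, isAgg f → S.arF f = 1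
  hat : S.F → D S → Option (D S)
  intC : ℤ → S.C
  int_ar : ∀ z, S.arC (intC z) = 0
  int_inj : Function.Injective intC
  cmpP : CmpOp → S.P
  cmp_ar : ∀ o, S.arP (cmpP o) = 2
  cmp_inj : Function.Injective cmpP

/-- The integer `z` as an element of the domain (a Herbrand constant). -/
def intD {S : Sig.{0}} (G : GZExt S) (z : ℤ) : D S :=
  atomD (HTerm.mk (G.intC z) fun i => Fin.elim0 (Fin.cast (G.int_ar z) i))

/-- The arithmetic comparison predicates have their standard meanings in
the interpretation `I`. -/
def ArithStd {S : Sig.{0}} (G : GZExt S) (I : Interp S) : Prop :=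
  ∀ (o : CmpOp) (ds : Fin (S.arP (G.cmpP o)) → D S) (w : W),
    (⟨G.cmpP o, ds⟩ : GAtom S) ∈ I.atoms w ↔
      ∃ a b : ℤ, ds (Fin.cast (G.cmp_ar o).symm 0) = intD G a ∧
        ds (Fin.cast (G.cmp_ar o).symm 1) = intD G b ∧ o.eval a b

/-- `I` is coherent w.r.t. aggregates: coherent w.r.t. intensional sets
and, for every aggregate name `f` and ground term `τ`,
`σʷ(f(τ)) = f̂(σʷ(τ))` whenever `σʷ(τ) ∈ 𝒮`, and `σᵗ(f(τ)) = u` otherwise. -/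
def AggCoherent {S : Sig.{0}} (G : GZExt S) (I : Interp S) : Prop :=
  I.Coherent ∧
    ∀ f, G.isAgg f → ∀ τ : GTerm S,
      (∀ w d, I.s w τ = some d → IsSetD d → I.s w (.func f fun _ => τ) = G.hat f d) ∧
      (¬ (∃ d, I.st τ = some d ∧ IsSetD d) → I.st (.func f fun _ => τ) = none)

/-! ### GZ formulas -/

/-- Ground GZ formulas without set atoms: built from (ground) predicate
atoms by `∧`, `∨`, `→` (and `⊥`).  These are the `0`-formulas allowed as
the condition of a GZ set name. -/
inductive GZB (S : Sig.{0}) : Type 1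
  | falsum : GZB S
  | patom : (p : S.P) → (Fin (S.arP p) → D S) → GZB S
  | and : GZB S → GZB S → GZB S
  | or : GZB S → GZB S → GZB S
  | imp : GZB S → GZB S → GZB S

/-- Ground GZ formulas: predicate atoms and set atoms
`f{x⃗ : φ(x⃗)} ⊴ n` (with `f` an aggregate name, `k+1` bound variables,
`φ` a `0`-formula and `n` an integer), combined by `∧`, `∨`, `→`. -/
inductive GZG {S : Sig.{0}} (G : GZExt S) : Type 1
  | falsum : GZG G
  | patom : (p : S.P) → (Fin (S.arP p) → D S) → GZG G
  | satom : (f : S.F) → G.isAgg f → (k : ℕ) →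
      ((Fin (k + 1) → D S) → GZB S) → CmpOp → ℤ → GZG G
  | and : GZG G → GZG G → GZG G
  | or : GZG G → GZG G → GZG G
  | imp : GZG G → GZG G → GZG G

/-- Classical satisfaction `T ⊨_cl` for formulas without set atoms. -/
def SatB {S : Sig.{0}} (T : Set (GAtom S)) : GZB S → Prop
  | .falsum => False
  | .patom p ds => (⟨p, ds⟩ : GAtom S) ∈ T
  | .and a b => SatB T a ∧ SatB T b
  | .or a b => SatB T a ∨ SatB T b
  | .imp a b => SatB T a → SatB T b

/-- Classical satisfaction `T ⊨_cl` for ground GZ formulas.  For a set atom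
`f{x⃗ : φ(x⃗)} ⊴ n`: `f̂` applied to the set `{c⃗ ∈ D^{|x⃗|} : T ⊨_cl φ(c⃗)}`
has some integer value `k` and `k ⊴ n` holds. -/
def SatG {S : Sig.{0}} {G : GZExt S} (T : Set (GAtom S)) : GZG G → Prop
  | .falsum => False
  | .patom p ds => (⟨p, ds⟩ : GAtom S) ∈ T
  | .satom f _ k body o n =>
      ∃ (d : D S) (z : ℤ),
        mkSet? { val | ∃ c : Fin (k + 1) → D S, SatB T (body c) ∧ val = famToTup c } = some d ∧
        G.hat f d = some (intD G z) ∧ o.eval z n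
  | .and a b => SatG T a ∧ SatG T b
  | .or a b => SatG T a ∨ SatG T b
  | .imp a b => SatG T a → SatG T b

/-- A formula without set atoms as an `SQHT⁼_𝒮` formula. -/
def GZB.toF {S : Sig.{0}} : GZB S → Formula S
  | .falsum => .falsum
  | .patom p ds => .atom p fun i => .dom (ds i)
  | .and a b => .and a.toF b.toF
  | .or a b => .or a.toF b.toF
  | .imp a b => .imp a.toF b.toF

/-- The set name `{x⃗ : φ(x⃗)}` (that is, `{x⃗ : x⃗ : φ(x⃗)}`) as an
intensional-set term. -/
def setName {S : Sig.{0}} (k : ℕ) (body : (Fin (k + 1) → D S) → GZB S) : GTerm S :=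
  .iset (k + 1) k (fun c i => .dom (c i)) fun c => (body c).toF

/-- The comparison atom `τ₁ ⊴ τ₂` as an `SQHT⁼_𝒮` formula. -/
def cmpAtom {S : Sig.{0}} (G : GZExt S) (o : CmpOp) (t1 t2 : GTerm S) : Formula S :=
  .atom (G.cmpP o) fun i => (fun j : Fin 2 => if j = 0 then t1 else t2) (Fin.cast (G.cmp_ar o) i)

/-- A ground GZ formula as an `SQHT⁼_𝒮` formula: the set atom
`f{x⃗ : φ(x⃗)} ⊴ n` becomes the atom `⊴(f({x⃗ : φ(x⃗)}), n)`. -/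
def GZG.toF {S : Sig.{0}} {G : GZExt S} : GZG G → Formula S
  | .falsum => .falsum
  | .patom p ds => .atom p fun i => .dom (ds i)
  | .satom f _ k body o n =>
      cmpAtom G o (.func f fun _ => setName k body) (.dom (intD G n))
  | .and a b => .and a.toF b.toF
  | .or a b => .or a.toF b.toF
  | .imp a b => .imp a.toF b.toF

/-- A GZ formula: the universal closure `∀x⃗ φ(x⃗)` of a ground GZ formula
with `k` free variables. -/
structure GZSent {S : Sig.{0}} (G : GZExt S) : Type 1 where
  k : ℕ
  body : (Fin k → D S) → GZG G

/-- Iterated universal quantification over `k` variables. -/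
def allk {S : Sig.{0}} : (k : ℕ) → ((Fin k → D S) → Formula S) → Formula S
  | 0, f => f fun i => i.elim0
  | k + 1, f => .all fun d => allk k fun c => f (Fin.cons d c)

/-- A GZ formula as an `SQHT⁼_𝒮` formula (its universal closure). -/
def GZSent.toF {S : Sig.{0}} {G : GZExt S} (s : GZSent G) : Formula S :=
  allk s.k fun c => (s.body c).toF

/-- The grounding `Gr(Γ)` of a GZ theory: all ground instances of its
formulas. -/
def GrOf {S : Sig.{0}} {G : GZExt S} (Γ : Set (GZSent G)) : Set (GZG G) :=
  { g | ∃ s ∈ Γ, ∃ c, g = s.body c }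

/-! ### Stable models on the `SQHT⁼_𝒮` side (with aggregates) -/

/-- `I` is a model (w.r.t. aggregates) of the theory `Γ`: `I` is an
interpretation, coherent w.r.t. aggregates, interpreting arithmetic
standardly, with `I, h ⊨_𝒮 φ` for every `φ ∈ Γ`. -/
def ModelAgg {S : Sig.{0}} (G : GZExt S) (I : Interp S) (Γ : Set (Formula S)) : Prop :=
  I.Valid ∧ AggCoherent G I ∧ ArithStd G I ∧ ∀ φ ∈ Γ, SatS I .h φ

/-- `T` is a stable model of `Γ` under the `SQHT⁼_𝒮` equilibrium semantics
with interpretations coherent w.r.t. aggregates. -/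
def StableAgg {S : Sig.{0}} (G : GZExt S) (Γ : Set (Formula S)) (T : Set (GAtom S)) : Prop :=
  ∃ σ, ModelAgg G (totalI σ T) Γ ∧ ∀ I', ILt I' (totalI σ T) → ¬ ModelAgg G I' Γ

/-! ### The GZ reduct -/

/-- The target language of the GZ reduct: ground formulas with (possibly
infinitary) conjunctions. -/
inductive RForm (S : Sig.{0}) : Type 2
  | falsum : RForm S
  | patom : (p : S.P) → (Fin (S.arP p) → D S) → RForm S
  | and : RForm S → RForm S → RForm S
  | or : RForm S → RForm S → RForm S
  | imp : RForm S → RForm S → RForm S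
  | conj : (ι : Type 1) → (ι → RForm S) → RForm S

/-- Classical satisfaction for reduct formulas. -/
def SatR {S : Sig.{0}} (T : Set (GAtom S)) : RForm S → Prop
  | .falsum => False
  | .patom p ds => (⟨p, ds⟩ : GAtom S) ∈ T
  | .and a b => SatR T a ∧ SatR T b
  | .or a b => SatR T a ∨ SatR T b
  | .imp a b => SatR T a → SatR T b
  | .conj _ f => ∀ i, SatR T (f i)

/-- The reduct `φ^T` of a formula without set atoms. -/
def GZB.reduct {S : Sig.{0}} (T : Set (GAtom S)) : GZB S → RForm S
  | .falsum => .falsum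
  | .patom p ds => if (⟨p, ds⟩ : GAtom S) ∈ T then .patom p ds else .falsum
  | .and a b => if SatB T (.and a b) then .and (a.reduct T) (b.reduct T) else .falsum
  | .or a b => if SatB T (.or a b) then .or (a.reduct T) (b.reduct T) else .falsum
  | .imp a b => if SatB T (.imp a b) then .imp (a.reduct T) (b.reduct T) else .falsum

/-- The GZ reduct `φ^T` of a ground GZ formula w.r.t. `T`: `⊥` if
`T ⊭_cl φ`; a satisfied set atom `f{x⃗ : ψ(x⃗)} ⊴ n` becomes
`(⋀ Gr⁺_T(ψ(x⃗)))^T`, the conjunction of the reducts of all ground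
instances of `ψ` classically satisfied by `T`. -/
def GZG.reduct {S : Sig.{0}} {G : GZExt S} (T : Set (GAtom S)) : GZG G → RForm S
  | .falsum => .falsum
  | .patom p ds => if (⟨p, ds⟩ : GAtom S) ∈ T then .patom p ds else .falsum
  | .satom f hf k body o n =>
      if SatG T (.satom f hf k body o n) then
        .conj { c : Fin (k + 1) → D S // SatB T (body c) } fun c => (body c.1).reduct T
      else .falsum
  | .and a b => if SatG T (.and a b) then .and (a.reduct T) (b.reduct T) else .falsum
  | .or a b => if SatG T (.or a b) then .or (a.reduct T) (b.reduct T) else .falsum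
  | .imp a b => if SatG T (.imp a b) then .imp (a.reduct T) (b.reduct T) else .falsum

/-- `T` is the `⊆`-minimal (classical) model of a set of reduct formulas. -/
def MinModel {S : Sig.{0}} (T : Set (GAtom S)) (Φ : Set (RForm S)) : Prop :=
  (∀ ψ ∈ Φ, SatR T ψ) ∧ ∀ T' ⊆ T, (∀ ψ ∈ Φ, SatR T' ψ) → T' = T

/-- `T` is a GZ-stable model of the GZ theory `Γ`: `T` is the `⊆`-minimal
model of the reduct `Gr(Γ)^T`. -/
def GZStable {S : Sig.{0}} {G : GZExt S} (Γ : Set (GZSent G)) (T : Set (GAtom S)) : Prop :=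
  MinModel T { r | ∃ g ∈ GrOf Γ, r = GZG.reduct T g }

theorem atomD_injective {A : Type} : Function.Injective (atomD : A → DD A) := by
  intro a b hab
  let f : DD A → Option A := Quot.lift
    (fun x => match x.1 with
      | .atom a => some a
      | .set _ _ _ => none)
    (by
      rintro ⟨x, hx⟩ ⟨y, hy⟩ ⟨n, hn⟩
      cases x <;> cases y <;> cases n <;> simp_all [PD.EquivLe])
  have h : f (atomD a) = f (atomD b) := congrArg f hab
  simpa [f, atomD, toD] using h

theorem intD_injective {S : Sig.{0}} (G : GZExt S) : Function.Injective (intD G) := by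
  intro a b hab
  have h := atomD_injective hab
  injection h with h
  exact G.int_inj h

theorem famToTup_injective {α : Type u} {n : ℕ} :
    Function.Injective (famToTup : (Fin (n + 1) → α) → Tup α) := by
  intro g g' h
  obtain ⟨h0, h1⟩ := Prod.mk.inj h
  have h2 := List.ofFn_injective h1
  funext i
  refine Fin.cases h0 (fun j => ?_) i
  exact congrFun h2 j

theorem mkSet?_eq_some {A : Type} {s : Set (Tup (DD A))} {d : DD A} (h : mkSet? s = some d) :
    IsSetD d ∧ ∀ v, dmem v d ↔ v ∈ s := by
  unfold mkSet? at h
  split_ifs at h with hs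
  obtain rfl := Option.some.inj h
  exact hs.choose_spec

theorem eq_of_mkSet?_eq_some {A : Type} {s s' : Set (Tup (DD A))} {d : DD A}
    (h : mkSet? s = some d) (h' : mkSet? s' = some d) : s = s' :=
  Set.ext fun v => ((mkSet?_eq_some h).2 v).symm.trans ((mkSet?_eq_some h').2 v)

theorem Interp.Valid.assignValid {S : Sig.{v}} {I : Interp S} (hV : I.Valid) (w : W) :
    AssignValid (I.s w) := by
  cases w
  · exact hV.1
  · exact hV.2.1

theorem Interp.Valid.s_dom {S : Sig.{v}} {I : Interp S} (hV : I.Valid) (w : W) (d : D S) :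
    I.s w (.dom d) = some d :=
  (hV.assignValid w).1 d

theorem Interp.Valid.satS_atom_dom {S : Sig.{v}} {I : Interp S} (hV : I.Valid) (w : W) (p : S.P)
    (ds : Fin (S.arP p) → D S) :
    SatS I w (.atom p fun i => .dom (ds i)) ↔ (⟨p, ds⟩ : GAtom S) ∈ I.atoms w := by
  simp only [SatS, hV.s_dom]
  constructor
  · rintro ⟨ds', h, hm⟩
    obtain rfl : ds = ds' := funext fun i => Option.some.inj (h i)
    exact hm
  · exact fun hm => ⟨ds, fun _ => rfl, hm⟩

theorem satS_t_imp {S : Sig.{v}} (I : Interp S) (a b : Formula S) :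
    SatS I .t (.imp a b) ↔ (SatS I .t a → SatS I .t b) := by
  simp only [SatS]
  constructor
  · exact fun h => h .t trivial
  · rintro h (_ | _) hw
    · exact hw.elim
    · exact h

theorem satS_h_imp {S : Sig.{v}} (I : Interp S) (a b : Formula S) :
    SatS I .h (.imp a b) ↔
      (SatS I .h a → SatS I .h b) ∧ (SatS I .t a → SatS I .t b) := by
  simp only [SatS]
  constructor
  · exact fun h => ⟨h .h trivial, h .t trivial⟩
  · rintro ⟨h, h'⟩ (_ | _) -
    · exact h
    · exact h'

theorem satS_t_toF_iff_satB {S : Sig.{0}} {I : Interp S} (hV : I.Valid) (b : GZB S) :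
    SatS I .t b.toF ↔ SatB I.It b := by
  induction b with
  | falsum => simp [GZB.toF, SatS, SatB]
  | patom p ds => exact hV.satS_atom_dom .t p ds
  | and a b iha ihb => simp only [GZB.toF, SatS, SatB, iha, ihb]
  | or a b iha ihb => simp only [GZB.toF, SatS, SatB, iha, ihb]
  | imp a b iha ihb => simp only [GZB.toF, satS_t_imp, SatB, iha, ihb]

theorem satB_of_satR_reduct {S : Sig.{0}} {H T : Set (GAtom S)} {b : GZB S}
    (h : SatR H (b.reduct T)) : SatB T b := by
  cases b <;> simp only [GZB.reduct] at h
  case falsum => exact h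
  all_goals
    split_ifs at h with hT
    · exact hT
    · exact h.elim

theorem satG_of_satR_reduct {S : Sig.{0}} {G : GZExt S} {H T : Set (GAtom S)} {φ : GZG G}
    (h : SatR H (φ.reduct T)) : SatG T φ := by
  cases φ <;> simp only [GZG.reduct] at h
  case falsum => exact h
  all_goals
    split_ifs at h with hT
    · exact hT
    · exact h.elim

theorem satS_h_toF_iff_satR_reduct {S : Sig.{0}} {I : Interp S} (hV : I.Valid) (b : GZB S) :
    SatS I .h b.toF ↔ SatR I.Ih (b.reduct I.It) := by
  induction b with
  | falsum => simp [GZB.toF, GZB.reduct, SatS, SatR]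
  | patom p ds =>
    refine (hV.satS_atom_dom .h p ds).trans ?_
    simp only [GZB.reduct]
    split_ifs with h
    · rfl
    · exact iff_of_false (fun h' => h (hV.2.2.2 h')) id
  | and a b iha ihb =>
    simp only [GZB.toF, SatS, GZB.reduct, iha, ihb]
    split_ifs with h
    · rfl
    · exact iff_of_false (fun h' => h ⟨satB_of_satR_reduct h'.1, satB_of_satR_reduct h'.2⟩) id
  | or a b iha ihb =>
    simp only [GZB.toF, SatS, GZB.reduct, iha, ihb]
    split_ifs with h
    · rfl
    · exact iff_of_false (fun h' => h (h'.imp satB_of_satR_reduct satB_of_satR_reduct)) id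
  | imp a b iha ihb =>
    simp only [GZB.toF, satS_h_imp, GZB.reduct, iha, ihb, satS_t_toF_iff_satB hV]
    split_ifs with h
    · exact and_iff_left h
    · exact iff_of_false (fun h' => h h'.2) id

theorem extw_setName {S : Sig.{0}} {I : Interp S} (hV : I.Valid) (w : W) (k : ℕ)
    (body : (Fin (k + 1) → D S) → GZB S) :
    extw I w (k + 1) k (fun c i => .dom (c i)) (fun c => (body c).toF) =
      mkSet? { val | ∃ c, SatS I w (body c).toF ∧ val = famToTup c } := by
  unfold extw
  rw [if_neg (by simp [hV.s_dom])]
  congr 1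
  ext val
  simp only [Set.mem_ofPred_eq, hV.s_dom]
  constructor
  · rintro ⟨c, ds, hs, hd, rfl⟩
    obtain rfl : c = ds := funext fun i => Option.some.inj (hd i)
    exact ⟨c, hs, rfl⟩
  · rintro ⟨c, hs, rfl⟩
    exact ⟨c, c, hs, fun _ => rfl, rfl⟩

theorem st_setName {S : Sig.{0}} {I : Interp S} (hV : I.Valid) (hC : I.Coherent) (k : ℕ)
    (body : (Fin (k + 1) → D S) → GZB S) :
    I.st (setName k body) =
      mkSet? { val | ∃ c, SatB I.It (body c) ∧ val = famToTup c } := by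
  have h : cval I .t (setName k body) = I.st (setName k body) :=
    congrFun (congrArg Interp.st hC) (setName k body)
  rw [← h]
  simp only [setName, cval, extw_setName hV, satS_t_toF_iff_satB hV]

theorem sh_setName {S : Sig.{0}} {I : Interp S} (hV : I.Valid) (hC : I.Coherent) (k : ℕ)
    (body : (Fin (k + 1) → D S) → GZB S) :
    I.sh (setName k body) =
      if mkSet? { val | ∃ c, SatR I.Ih ((body c).reduct I.It) ∧ val = famToTup c } =
          I.st (setName k body)
      then I.st (setName k body) else none := by
  have h : cval I .h (setName k body) = I.sh (setName k body) :=
    congrFun (congrArg Interp.sh hC) (setName k body)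
  rw [← h, st_setName hV hC]
  simp only [setName, cval, extw_setName hV, satS_t_toF_iff_satB hV,
    satS_h_toF_iff_satR_reduct hV]
  split_ifs with h
  · exact h
  · rfl

/-- At `h` a set name denotes the same set as at `t`, provided every instance of its condition
that holds at `t` already holds at `h`; otherwise it is undefined. -/
theorem sh_setName_eq_some_iff {S : Sig.{0}} {I : Interp S} (hV : I.Valid) (hC : I.Coherent)
    (k : ℕ) (body : (Fin (k + 1) → D S) → GZB S) (d : D S) :
    I.sh (setName k body) = some d ↔
      I.st (setName k body) = some d ∧
        ∀ c, SatB I.It (body c) → SatR I.Ih ((body c).reduct I.It) := by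
  rw [sh_setName hV hC]
  constructor
  · intro h
    split_ifs at h with heq
    refine ⟨h, fun c hc => ?_⟩
    have hset := eq_of_mkSet?_eq_some (heq.trans h) ((st_setName hV hC k body).symm.trans h)
    have hmem : famToTup c ∈ { val | ∃ c, SatB I.It (body c) ∧ val = famToTup c } :=
      ⟨c, hc, rfl⟩
    rw [← hset] at hmem
    obtain ⟨c', hc', hcc'⟩ := hmem
    rwa [famToTup_injective hcc']
  · rintro ⟨h, hall⟩
    rw [if_pos, h]
    rw [st_setName hV hC]
    congr 1
    ext val
    exact exists_congr fun c => and_congr_left fun _ => ⟨satB_of_satR_reduct, hall c⟩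

theorem satS_cmpAtom {S : Sig.{0}} {G : GZExt S} {I : Interp S} (hV : I.Valid)
    (hA : ArithStd G I) (w : W) (o : CmpOp) (τ : GTerm S) (n : ℤ) :
    SatS I w (cmpAtom G o τ (.dom (intD G n))) ↔
      ∃ z, I.s w τ = some (intD G z) ∧ o.eval z n := by
  simp only [cmpAtom, SatS]
  constructor
  · rintro ⟨ds, hds, hmem⟩
    obtain ⟨a, b, ha, hb, hab⟩ := (hA o ds w).1 hmem
    have h0 := hds (Fin.cast (G.cmp_ar o).symm 0)
    have h1 := hds (Fin.cast (G.cmp_ar o).symm 1)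
    simp only [Fin.cast_cast, Fin.cast_eq_self, if_true, ha] at h0
    simp only [Fin.cast_cast, Fin.cast_eq_self, one_ne_zero, if_false, hb, hV.s_dom] at h1
    obtain rfl := intD_injective G (Option.some.inj h1)
    exact ⟨a, h0, hab⟩
  · rintro ⟨z, hz, hev⟩
    refine ⟨fun i => if Fin.cast (G.cmp_ar o) i = 0 then intD G z else intD G n, fun i => ?_,
      (hA o _ w).2 ⟨z, n, ?_, ?_, hev⟩⟩
    · by_cases hi : Fin.cast (G.cmp_ar o) i = 0
      · simp only [hi, if_true, hz]
      · simp only [hi, if_false, hV.s_dom]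
    · simp
    · simp

/-- In an interpretation coherent with respect to aggregates, an aggregate term takes an integer
value exactly when its argument denotes a set and the associated function has that value. -/
theorem s_agg_eq_some_intD_iff {S : Sig.{0}} {G : GZExt S} {I : Interp S} (hV : I.Valid)
    (hC : AggCoherent G I) {f : S.F} (hf : G.isAgg f) (w : W) (τ : GTerm S) (z : ℤ) :
    I.s w (.func f fun _ => τ) = some (intD G z) ↔
      ∃ d, I.s w τ = some d ∧ IsSetD d ∧ G.hat f d = some (intD G z) := by
  obtain ⟨hset, hnot⟩ := hC.2 f hf τ
  constructor
  · intro h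
    have ht : I.st (.func f fun _ => τ) = some (intD G z) := by
      cases w with
      | t => exact h
      | h =>
        rcases hV.2.2.1 (.func f fun _ => τ) with h' | h'
        · exact h'.symm.trans h
        · exact absurd (h.symm.trans h') (by simp)
    obtain ⟨d, hd, hds⟩ : ∃ d, I.st τ = some d ∧ IsSetD d := by
      by_contra hne
      rw [hnot hne] at ht
      exact absurd ht (by simp)
    have hw : I.s w τ = some d := by
      cases w with
      | t => exact hd
      | h =>
        rcases hV.2.2.1 τ with h' | h'
        · exact h'.trans hd
        · have hnone := hV.1.2.2.2.2.1 f (fun _ => τ)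
            ⟨Fin.cast (G.agg_ar f hf).symm 0, h'⟩
          exact absurd (h.symm.trans hnone) (by simp)
    exact ⟨d, hw, hds, (hset w d hw hds).symm.trans h⟩
  · rintro ⟨d, hd, hds, hz⟩
    rw [hset w d hd hds, hz]

theorem satS_t_toF_iff_satG {S : Sig.{0}} {G : GZExt S} {I : Interp S} (hV : I.Valid)
    (hC : AggCoherent G I) (hA : ArithStd G I) (φ : GZG G) :
    SatS I .t φ.toF ↔ SatG I.It φ := by
  induction φ with
  | falsum => simp [GZG.toF, SatS, SatG]
  | patom p ds => exact hV.satS_atom_dom .t p ds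
  | satom f hf k body o n =>
    simp only [GZG.toF, satS_cmpAtom hV hA, s_agg_eq_some_intD_iff hV hC hf, SatG]
    rw [← st_setName hV hC.1]
    constructor
    · rintro ⟨z, ⟨d, hd, -, hz⟩, ho⟩
      exact ⟨d, z, hd, hz, ho⟩
    · rintro ⟨d, z, hd, hz, ho⟩
      exact ⟨z, ⟨d, hd, (mkSet?_eq_some ((st_setName hV hC.1 k body).symm.trans hd)).1, hz⟩, ho⟩
  | and a b iha ihb => simp only [GZG.toF, SatS, SatG, iha, ihb]
  | or a b iha ihb => simp only [GZG.toF, SatS, SatG, iha, ihb]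
  | imp a b iha ihb => simp only [GZG.toF, satS_t_imp, SatG, iha, ihb]

theorem satS_h_satom_iff {S : Sig.{0}} {G : GZExt S} {I : Interp S} (hV : I.Valid)
    (hC : AggCoherent G I) (hA : ArithStd G I) (f : S.F) (hf : G.isAgg f) (k : ℕ)
    (body : (Fin (k + 1) → D S) → GZB S) (o : CmpOp) (n : ℤ) :
    SatS I .h (GZG.satom f hf k body o n).toF ↔
      SatG I.It (.satom f hf k body o n) ∧
        ∀ c, SatB I.It (body c) → SatR I.Ih ((body c).reduct I.It) := by
  rw [← satS_t_toF_iff_satG hV hC hA]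
  simp only [GZG.toF, satS_cmpAtom hV hA, s_agg_eq_some_intD_iff hV hC hf]
  simp only [Interp.s, sh_setName_eq_some_iff hV hC.1]
  constructor
  · rintro ⟨z, ⟨d, ⟨hd, hall⟩, hz⟩, ho⟩
    exact ⟨⟨z, ⟨d, hd, hz⟩, ho⟩, hall⟩
  · rintro ⟨⟨z, ⟨d, hd, hz⟩, ho⟩, hall⟩
    exact ⟨z, ⟨d, ⟨hd, hall⟩, hz⟩, ho⟩

/-- For any ground GZ formula `φ` and any interpretation
`I = ⟨σʰ, σᵗ, H, T⟩` coherent w.r.t. aggregates: `I ⊨ φ` iff `H ⊨_cl φ^T`,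
where `φ^T` is the GZ reduct of `φ` w.r.t. `T`. -/
theorem sat_iff_satCl_reduct {S : Sig.{0}} (G : GZExt S) (I : Interp S)
    (hV : I.Valid) (hC : AggCoherent G I) (hA : ArithStd G I) (φ : GZG G) :
    SatS I .h φ.toF ↔ SatR I.Ih (GZG.reduct I.It φ) := by
  induction φ with
  | falsum => simp [GZG.toF, GZG.reduct, SatS, SatR]
  | patom p ds =>
    refine (hV.satS_atom_dom .h p ds).trans ?_
    simp only [GZG.reduct]
    split_ifs with h
    · rfl
    · exact iff_of_false (fun h' => h (hV.2.2.2 h')) id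
  | satom f hf k body o n =>
    rw [satS_h_satom_iff hV hC hA]
    simp only [GZG.reduct]
    split_ifs with h
    · simp only [h, true_and, SatR, Subtype.forall]
    · simp only [h, false_and, SatR]
  | and a b iha ihb =>
    simp only [GZG.toF, SatS, GZG.reduct, iha, ihb]
    split_ifs with h
    · rfl
    · exact iff_of_false (fun h' => h ⟨satG_of_satR_reduct h'.1, satG_of_satR_reduct h'.2⟩) id
  | or a b iha ihb =>
    simp only [GZG.toF, SatS, GZG.reduct, iha, ihb]
    split_ifs with h
    · rfl
    · exact iff_of_false (fun h' => h (h'.imp satG_of_satR_reduct satG_of_satR_reduct)) id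
  | imp a b iha ihb =>
    simp only [GZG.toF, satS_h_imp, GZG.reduct, iha, ihb, satS_t_toF_iff_satG hV hC hA]
    split_ifs with h
    · exact and_iff_left h
    · exact iff_of_false (fun h' => h h'.2) id

end
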